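/- arXiv:0910.2470 — 2 statements merged into one kernel-verified Lean document; each statement's English description precedes it below -/
import Mathlib

section
/- Fix β > 0 and α > 0 and suppose that the overlaps vanish in the thermodynamic limit uniformly below connectivity α, i.e. lim_{N→∞} sup_{α' ∈ (0,α]} ∑_{n=1}^∞ (θ^n/n) ⟨q_{1…n}²⟩_N(α',β) = 0, where θ = tanh β and ⟨·⟩_N(α',β) is the total average at connectivity α'. Then the thermodynamic limit of the quenched pressure exists and equals the high-temperature solution: lim_{N→∞} A_N(α,β) = ln 2 + α ln cosh β. -/
open scoped BigOperators

noncomputable section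

/-- The Poisson probability mass function with mean `lam`. -/
def pois (lam : ℝ) (k : ℕ) : ℝ := Real.exp (-lam) * lam ^ k / (Nat.factorial k)

/-- The spin value (±1) attached to a Boolean opinion. -/
def spin (b : Bool) : ℝ := if b then 1 else -1

/-- Average of `f` over `p` families of `k` i.i.d. indices, each uniform on `Fin N`. -/
def avgIdx (N : ℕ) (p k : ℕ) (f : (Fin p → Fin k → Fin N) → ℝ) : ℝ :=
  ((N : ℝ) ^ (p * k))⁻¹ * ∑ im : Fin p → Fin k → Fin N, f im

/-- The interaction sum `∑_{ν=1}^k σ_{i_ν^1} ⋯ σ_{i_ν^p}`; the Hamiltonian is its negative. -/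
def intSum {N p k : ℕ} (im : Fin p → Fin k → Fin N) (σ : Fin N → Bool) : ℝ :=
  ∑ ν : Fin k, ∏ l : Fin p, spin (σ (im l ν))

/-- The diluted `p`-spin Hamiltonian `H = -∑_{ν=1}^k σ_{i_ν^1} ⋯ σ_{i_ν^p}`. -/
def Hspin {N p k : ℕ} (im : Fin p → Fin k → Fin N) (σ : Fin N → Bool) : ℝ :=
  - intSum im σ

/-- Partition function `Z = ∑_σ e^{-β H(σ)}`. -/
def Zpart (β : ℝ) {N p k : ℕ} (im : Fin p → Fin k → Fin N) : ℝ :=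
  ∑ σ : Fin N → Bool, Real.exp (β * intSum im σ)

/-- Cavity term `∑_{ν=1}^{k'} σ_{i_ν^1} ⋯ σ_{i_ν^q}` (with `q = p - 1` families). -/
def cavSum {N q k' : ℕ} (im' : Fin q → Fin k' → Fin N) (σ : Fin N → Bool) : ℝ :=
  ∑ ν : Fin k', ∏ l : Fin q, spin (σ (im' l ν))

/-- Perturbed Boltzmann weight `exp(β(∑_ν σ_{i_ν^1}⋯σ_{i_ν^p} + ∑_ν σ_{i'_ν^1}⋯σ_{i'_ν^{q}}))`. -/
def wpert (β : ℝ) {N p k q k' : ℕ} (im : Fin p → Fin k → Fin N)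
    (im' : Fin q → Fin k' → Fin N) (σ : Fin N → Bool) : ℝ :=
  Real.exp (β * (intSum im σ + cavSum im' σ))

/-- Perturbed partition function. -/
def Zpert (β : ℝ) {N p k q k' : ℕ} (im : Fin p → Fin k → Fin N)
    (im' : Fin q → Fin k' → Fin N) : ℝ :=
  ∑ σ : Fin N → Bool, wpert β im im' σ

/-- Replicated (unperturbed) Boltzmann state `Ω(g)` on `s` replicas sharing the same disorder. -/
def OmegaB (β : ℝ) {N p k : ℕ} (im : Fin p → Fin k → Fin N)
    (s : ℕ) (g : (Fin s → Fin N → Bool) → ℝ) : ℝ :=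
  (∑ σs : Fin s → Fin N → Bool, g σs * ∏ a : Fin s, Real.exp (β * intSum im (σs a))) /
    (Zpart β im) ^ s

/-- Replicated perturbed Boltzmann state `Ω̃_t(g)` on `s` replicas sharing the same disorder. -/
def OmegaPert (β : ℝ) {N p k q k' : ℕ} (im : Fin p → Fin k → Fin N)
    (im' : Fin q → Fin k' → Fin N) (s : ℕ) (g : (Fin s → Fin N → Bool) → ℝ) : ℝ :=
  (∑ σs : Fin s → Fin N → Bool, g σs * ∏ a : Fin s, wpert β im im' (σs a)) /
    (Zpert β im im') ^ s

/-- Quenched expectation: the number of interaction terms is Poisson of mean `γ N` and the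
`p` index families are i.i.d. uniform on `Fin N`. -/
def Equench (N p : ℕ) (γ : ℝ) (f : (k : ℕ) → (Fin p → Fin k → Fin N) → ℝ) : ℝ :=
  ∑' k : ℕ, pois (γ * N) k * avgIdx N p k (fun im => f k im)

/-- Quenched expectation including the cavity randomness: the cavity term has a Poisson
number of terms of mean `2 γ t`, with `p - 1` independent uniform index families. -/
def EquenchCav (N p : ℕ) (γ t : ℝ)
    (f : (k : ℕ) → (Fin p → Fin k → Fin N) →
         (k' : ℕ) → (Fin (p - 1) → Fin k' → Fin N) → ℝ) : ℝ :=
  ∑' k : ℕ, pois (γ * N) k * avgIdx N p k (fun im =>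
    ∑' k' : ℕ, pois (2 * γ * t) k' * avgIdx N (p - 1) k' (fun im' => f k im k' im'))

/-- Quenched average of `ln Z_N`. -/
def ElnZ (N p : ℕ) (γ β : ℝ) : ℝ :=
  Equench N p γ (fun _ im => Real.log (Zpart β im))

/-- Quenched pressure `A_N = (1/N) E[ln Z_N]`. -/
def pressure (N p : ℕ) (γ β : ℝ) : ℝ :=
  (N : ℝ)⁻¹ * ElnZ N p γ β

/-- Cavity function `Ψ_N(t) = E[ln (Z_{N,t} / Z_N)]`. -/
def cavityFn (N p : ℕ) (γ β t : ℝ) : ℝ :=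
  EquenchCav N p γ t (fun _ im _ im' => Real.log (Zpert β im im' / Zpart β im))

/-- The multi-overlap `q_{1…n} = (1/N) ∑_i σ_i^{(1)} ⋯ σ_i^{(n)}` of `n` replicas. -/
def qOv (N n : ℕ) (σs : Fin n → Fin N → Bool) : ℝ :=
  (N : ℝ)⁻¹ * ∑ x : Fin N, ∏ a : Fin n, spin (σs a x)

/-- Total (quenched) average `⟨q_{1…n}^r⟩_N` of the `r`-th power of the `n`-replica overlap. -/
def qPowAvg (N p : ℕ) (γ β : ℝ) (n r : ℕ) : ℝ :=
  Equench N p γ (fun _ im => OmegaB β im n (fun σs => (qOv N n σs) ^ r))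

/-- Perturbed total average `⟨q_{1…n}^r⟩_{N,t}` of the `r`-th power of the `n`-replica overlap. -/
def qPowAvgPert (N p : ℕ) (γ β t : ℝ) (n r : ℕ) : ℝ :=
  EquenchCav N p γ t (fun _ im _ im' => OmegaPert β im im' n (fun σs => (qOv N n σs) ^ r))

end

open Filter

noncomputable section

lemma abs_spin (b : Bool) : |spin b| = 1 := by
  cases b <;> simp [spin]

lemma abs_prod_spin {ι : Type*} [Fintype ι] (f : ι → Bool) : |∏ l, spin (f l)| = 1 := by
  simp [Finset.abs_prod, abs_spin]

lemma exp_mul_of_abs_eq_one (β : ℝ) {s : ℝ} (hs : |s| = 1) :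
    Real.exp (β * s) = Real.cosh β * (1 + Real.tanh β * s) := by
  have h : Real.cosh β * (1 + Real.tanh β * s) = Real.cosh β + Real.sinh β * s := by
    rw [Real.tanh_eq_sinh_div_cosh]
    field_simp [(Real.cosh_pos β).ne']
  rw [h]
  rcases eq_or_eq_neg_of_abs_eq hs with rfl | rfl
  · simp [Real.cosh_add_sinh]
  · simp [← sub_eq_add_neg, Real.cosh_sub_sinh]

lemma Zpart_pos (β : ℝ) {N p k : ℕ} (im : Fin p → Fin k → Fin N) : 0 < Zpart β im :=
  Finset.sum_pos (fun _ _ => Real.exp_pos _) Finset.univ_nonempty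

lemma tanh_pos_of_pos {β : ℝ} (hβ : 0 < β) : 0 < Real.tanh β := by
  rw [Real.tanh_eq_sinh_div_cosh]
  exact div_pos (Real.sinh_pos_iff.2 hβ) (Real.cosh_pos β)

/-! ### Uniform averages over the interaction indices -/

lemma avgIdx_const {N : ℕ} (hN : N ≠ 0) (p k : ℕ) (c : ℝ) : avgIdx N p k (fun _ => c) = c := by
  have hN' : (N : ℝ) ^ (p * k) ≠ 0 := pow_ne_zero _ (Nat.cast_ne_zero.2 hN)
  simp only [avgIdx, Finset.sum_const, Finset.card_univ, Fintype.card_pi, Fintype.card_fin,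
    Finset.prod_const, nsmul_eq_mul, Nat.cast_pow]
  rw [← pow_mul, mul_comm k p, inv_mul_cancel_left₀ hN']

lemma avgIdx_mono {N p k : ℕ} {f g : (Fin p → Fin k → Fin N) → ℝ} (h : ∀ im, f im ≤ g im) :
    avgIdx N p k f ≤ avgIdx N p k g :=
  mul_le_mul_of_nonneg_left (Finset.sum_le_sum fun im _ => h im) (by positivity)

lemma avgIdx_nonneg {N p k : ℕ} {f : (Fin p → Fin k → Fin N) → ℝ} (h : ∀ im, 0 ≤ f im) :
    0 ≤ avgIdx N p k f :=
  mul_nonneg (by positivity) (Finset.sum_nonneg fun im _ => h im)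

lemma avgIdx_add {N p k : ℕ} (f g : (Fin p → Fin k → Fin N) → ℝ) :
    avgIdx N p k (fun im => f im + g im) = avgIdx N p k f + avgIdx N p k g := by
  simp only [avgIdx, Finset.sum_add_distrib, mul_add]

lemma hasSum_avgIdx {N p k : ℕ} {f : ℕ → (Fin p → Fin k → Fin N) → ℝ}
    {s : (Fin p → Fin k → Fin N) → ℝ} (h : ∀ im, HasSum (fun n => f n im) (s im)) :
    HasSum (fun n => avgIdx N p k (f n)) (avgIdx N p k s) :=
  (hasSum_sum fun im _ => h im).mul_left _

/-- Prepending one more interaction term, with indices `e`, to the index families `im`. -/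
def consIdx {N p k : ℕ} (e : Fin p → Fin N) (im : Fin p → Fin k → Fin N) :
    Fin p → Fin (k + 1) → Fin N :=
  fun l => Fin.cons (e l) (im l)

lemma avgIdx_succ (N p k : ℕ) (f : (Fin p → Fin (k + 1) → Fin N) → ℝ) :
    avgIdx N p (k + 1) f =
      avgIdx N p k (fun im => ((N : ℝ) ^ p)⁻¹ * ∑ e : Fin p → Fin N, f (consIdx e im)) := by
  let φ : (Fin p → Fin N) × (Fin p → Fin k → Fin N) ≃ (Fin p → Fin (k + 1) → Fin N) :=
    { toFun := fun x => consIdx x.1 x.2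
      invFun := fun im => (fun l => im l 0, fun l => Fin.tail (im l))
      left_inv := fun x => by simp [consIdx]
      right_inv := fun im => by funext l; simp [consIdx] }
  have h : ∑ im, f im = ∑ im, ∑ e : Fin p → Fin N, f (consIdx e im) := by
    rw [← φ.sum_comp, Fintype.sum_prod_type_right]
    rfl
  rw [avgIdx, avgIdx, h, ← Finset.mul_sum, ← mul_assoc, mul_add, mul_one, pow_add, mul_inv]

lemma intSum_consIdx {N p k : ℕ} (e : Fin p → Fin N) (im : Fin p → Fin k → Fin N)
    (σ : Fin N → Bool) :
    intSum (consIdx e im) σ = ∏ l, spin (σ (e l)) + intSum im σ := by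
  simp [intSum, consIdx, Fin.sum_univ_succ]

/-! ### Adding one interaction term -/

/-- The Boltzmann average of the interaction term with indices `e`. -/
def edgeMean (β : ℝ) {N p k : ℕ} (im : Fin p → Fin k → Fin N) (e : Fin p → Fin N) : ℝ :=
  (∑ σ : Fin N → Bool, (∏ l, spin (σ (e l))) * Real.exp (β * intSum im σ)) / Zpart β im

lemma abs_edgeMean_le_one (β : ℝ) {N p k : ℕ} (im : Fin p → Fin k → Fin N) (e : Fin p → Fin N) :
    |edgeMean β im e| ≤ 1 := by
  rw [edgeMean, abs_div, abs_of_pos (Zpart_pos β im), div_le_one (Zpart_pos β im)]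
  refine (Finset.abs_sum_le_sum_abs _ _).trans_eq (Finset.sum_congr rfl fun σ _ => ?_)
  rw [abs_mul, abs_prod_spin, one_mul, Real.abs_exp]

lemma Zpart_consIdx (β : ℝ) {N p k : ℕ} (e : Fin p → Fin N) (im : Fin p → Fin k → Fin N) :
    Zpart β (consIdx e im) =
      Real.cosh β * Zpart β im * (1 + Real.tanh β * edgeMean β im e) := by
  have h : Zpart β (consIdx e im) = Real.cosh β * (Zpart β im + Real.tanh β *
      ∑ σ : Fin N → Bool, (∏ l, spin (σ (e l))) * Real.exp (β * intSum im σ)) := by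
    simp only [Zpart]
    rw [Finset.mul_sum, ← Finset.sum_add_distrib, Finset.mul_sum]
    refine Finset.sum_congr rfl fun σ _ => ?_
    rw [intSum_consIdx, mul_add, Real.exp_add, exp_mul_of_abs_eq_one β (abs_prod_spin _)]
    ring
  rw [h, edgeMean]
  field_simp [(Zpart_pos β im).ne']

lemma abs_tanh_mul_edgeMean_lt_one (β : ℝ) {N p k : ℕ} (im : Fin p → Fin k → Fin N)
    (e : Fin p → Fin N) : |Real.tanh β * edgeMean β im e| < 1 := by
  rw [abs_mul]
  exact (mul_le_of_le_one_right (abs_nonneg _) (abs_edgeMean_le_one β im e)).trans_lt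
    (Real.abs_tanh_lt_one β)

lemma log_Zpart_consIdx (β : ℝ) {N p k : ℕ} (e : Fin p → Fin N) (im : Fin p → Fin k → Fin N) :
    Real.log (Zpart β (consIdx e im)) = Real.log (Real.cosh β) + Real.log (Zpart β im) +
      Real.log (1 + Real.tanh β * edgeMean β im e) := by
  have h := (abs_lt.1 (abs_tanh_mul_edgeMean_lt_one β im e)).1
  rw [Zpart_consIdx, Real.log_mul (mul_pos (Real.cosh_pos β) (Zpart_pos β im)).ne' (by linarith),
    Real.log_mul (Real.cosh_pos β).ne' (Zpart_pos β im).ne']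

lemma average_edgeMean_pow (β : ℝ) {N p k : ℕ} (im : Fin p → Fin k → Fin N) (n : ℕ) :
    ((N : ℝ) ^ p)⁻¹ * ∑ e : Fin p → Fin N, edgeMean β im e ^ n =
      OmegaB β im n (fun σs => qOv N n σs ^ p) := by
  have hq (σs : Fin n → Fin N → Bool) : qOv N n σs ^ p =
      ((N : ℝ) ^ p)⁻¹ * ∑ e : Fin p → Fin N, ∏ a, ∏ l, spin (σs a (e l)) := by
    rw [qOv, mul_pow, inv_pow, Fintype.sum_pow]
    exact congrArg _ (Finset.sum_congr rfl fun e _ => Finset.prod_comm)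
  simp only [OmegaB, edgeMean, div_pow, hq]
  rw [← Finset.sum_div, ← mul_div_assoc]
  congr 1
  simp only [Fintype.sum_pow, Finset.prod_mul_distrib, mul_assoc, Finset.sum_mul]
  rw [← Finset.mul_sum, Finset.sum_comm]

lemma OmegaB_qOv_pow_nonneg (β : ℝ) {N p k : ℕ} (hp : Even p) (im : Fin p → Fin k → Fin N)
    (n : ℕ) : 0 ≤ OmegaB β im n (fun σs => qOv N n σs ^ p) :=
  div_nonneg (Finset.sum_nonneg fun _ _ => mul_nonneg (hp.pow_nonneg _)
    (Finset.prod_nonneg fun _ _ => (Real.exp_pos _).le)) (pow_nonneg (Zpart_pos β im).le _)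

lemma OmegaB_qOv_pow_le_one (β : ℝ) {N p k : ℕ} (hN : N ≠ 0) (im : Fin p → Fin k → Fin N)
    (n : ℕ) : OmegaB β im n (fun σs => qOv N n σs ^ p) ≤ 1 := by
  have hN' : (0 : ℝ) < (N : ℝ) ^ p := pow_pos (Nat.cast_pos.2 (Nat.pos_of_ne_zero hN)) _
  rw [← average_edgeMean_pow, inv_mul_le_iff₀ hN', mul_one]
  calc ∑ e : Fin p → Fin N, edgeMean β im e ^ n ≤ ∑ _e : Fin p → Fin N, (1 : ℝ) :=
        Finset.sum_le_sum fun e _ => (le_abs_self _).trans <| by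
          rw [abs_pow]; exact pow_le_one₀ (abs_nonneg _) (abs_edgeMean_le_one β im e)
    _ = (N : ℝ) ^ p := by simp

lemma hasSum_average_log (β : ℝ) {N p k : ℕ} (im : Fin p → Fin k → Fin N) :
    HasSum (fun n : ℕ => -((-Real.tanh β) ^ (n + 1) / ((n : ℝ) + 1)) *
        OmegaB β im (n + 1) (fun σs => qOv N (n + 1) σs ^ p))
      (((N : ℝ) ^ p)⁻¹ * ∑ e : Fin p → Fin N, Real.log (1 + Real.tanh β * edgeMean β im e)) := by
  have h (e : Fin p → Fin N) : HasSum
      (fun n : ℕ => -((-Real.tanh β) ^ (n + 1) / ((n : ℝ) + 1)) * edgeMean β im e ^ (n + 1))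
      (Real.log (1 + Real.tanh β * edgeMean β im e)) := by
    have h := (Real.hasSum_pow_div_log_of_abs_lt_one
      (x := -(Real.tanh β * edgeMean β im e))
      (by rw [abs_neg]; exact abs_tanh_mul_edgeMean_lt_one β im e)).neg
    rw [neg_neg, sub_neg_eq_add] at h
    refine h.congr_fun fun n => ?_
    rw [← neg_mul, mul_pow]
    ring
  refine ((hasSum_sum fun e (_ : e ∈ Finset.univ) => h e).mul_left
    ((N : ℝ) ^ p)⁻¹).congr_fun fun n => ?_
  rw [← average_edgeMean_pow, ← Finset.mul_sum]
  ring

lemma summable_tanh_pow_div (β : ℝ) :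
    Summable (fun n : ℕ => Real.tanh β ^ (n + 1) / ((n : ℝ) + 1)) :=
  (Real.hasSum_pow_div_log_of_abs_lt_one (Real.abs_tanh_lt_one β)).summable

lemma tanh_pow_div_nonneg {β : ℝ} (hβ : 0 < β) (n : ℕ) :
    0 ≤ Real.tanh β ^ (n + 1) / ((n : ℝ) + 1) := by
  have : 0 < Real.tanh β := tanh_pos_of_pos hβ
  positivity

/-- The weighted sum of the averaged overlap moments, at fixed number `k` of interactions. -/
def overlapSum (β : ℝ) (N p k : ℕ) : ℝ :=
  ∑' n : ℕ, Real.tanh β ^ (n + 1) / ((n : ℝ) + 1) *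
    avgIdx N p k (fun im => OmegaB β im (n + 1) (fun σs => qOv N (n + 1) σs ^ p))

/-- The average of `ln Z` at fixed number `k` of interactions. -/
def meanLogZ (β : ℝ) (N p k : ℕ) : ℝ :=
  avgIdx N p k (fun im => Real.log (Zpart β im))

section Increment

variable {β : ℝ} {N p : ℕ}

lemma avgIdx_OmegaB_nonneg (hp : Even p) (k n : ℕ) :
    0 ≤ avgIdx N p k (fun im => OmegaB β im n (fun σs => qOv N n σs ^ p)) :=
  avgIdx_nonneg fun im => OmegaB_qOv_pow_nonneg β hp im n

lemma avgIdx_OmegaB_le_one (hN : N ≠ 0) (k n : ℕ) :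
    avgIdx N p k (fun im => OmegaB β im n (fun σs => qOv N n σs ^ p)) ≤ 1 :=
  (avgIdx_mono fun im => OmegaB_qOv_pow_le_one β hN im n).trans_eq (avgIdx_const hN p k 1)

lemma summable_overlapSum (hβ : 0 < β) (hN : N ≠ 0) (hp : Even p) (k : ℕ) :
    Summable (fun n : ℕ => Real.tanh β ^ (n + 1) / ((n : ℝ) + 1) *
      avgIdx N p k (fun im => OmegaB β im (n + 1) (fun σs => qOv N (n + 1) σs ^ p))) :=
  Summable.of_nonneg_of_le
    (fun n => mul_nonneg (tanh_pow_div_nonneg hβ n) (avgIdx_OmegaB_nonneg hp k _))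
    (fun n => mul_le_of_le_one_right (tanh_pow_div_nonneg hβ n) (avgIdx_OmegaB_le_one hN k _))
    (summable_tanh_pow_div β)

lemma overlapSum_nonneg (hβ : 0 < β) (hp : Even p) (k : ℕ) : 0 ≤ overlapSum β N p k :=
  tsum_nonneg fun n => mul_nonneg (tanh_pow_div_nonneg hβ n) (avgIdx_OmegaB_nonneg hp k _)

lemma overlapSum_le (hβ : 0 < β) (hN : N ≠ 0) (hp : Even p) (k : ℕ) :
    overlapSum β N p k ≤ ∑' n : ℕ, Real.tanh β ^ (n + 1) / ((n : ℝ) + 1) :=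
  (summable_overlapSum hβ hN hp k).tsum_le_tsum
    (fun n => mul_le_of_le_one_right (tanh_pow_div_nonneg hβ n) (avgIdx_OmegaB_le_one hN k _))
    (summable_tanh_pow_div β)

lemma abs_meanLogZ_succ_sub_le (hβ : 0 < β) (hN : N ≠ 0) (hp : Even p) (k : ℕ) :
    |meanLogZ β N p (k + 1) - meanLogZ β N p k - Real.log (Real.cosh β)| ≤
      overlapSum β N p k := by
  have hN' : (N : ℝ) ^ p ≠ 0 := pow_ne_zero _ (Nat.cast_ne_zero.2 hN)
  have hdiff : meanLogZ β N p (k + 1) - meanLogZ β N p k - Real.log (Real.cosh β) =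
      avgIdx N p k (fun im => ((N : ℝ) ^ p)⁻¹ *
        ∑ e : Fin p → Fin N, Real.log (1 + Real.tanh β * edgeMean β im e)) := by
    have h (im : Fin p → Fin k → Fin N) :
        ((N : ℝ) ^ p)⁻¹ * ∑ e : Fin p → Fin N, Real.log (Zpart β (consIdx e im)) =
          Real.log (Real.cosh β) + (Real.log (Zpart β im) + ((N : ℝ) ^ p)⁻¹ *
            ∑ e : Fin p → Fin N, Real.log (1 + Real.tanh β * edgeMean β im e)) := by
      simp only [log_Zpart_consIdx, Finset.sum_add_distrib, Finset.sum_const, Finset.card_univ,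
        Fintype.card_pi, Fintype.card_fin, Finset.prod_const, nsmul_eq_mul, Nat.cast_pow]
      field_simp
      ring
    simp only [meanLogZ, avgIdx_succ, h]
    rw [avgIdx_add, avgIdx_add, avgIdx_const hN]
    ring
  rw [hdiff, ← (hasSum_avgIdx fun im => hasSum_average_log β im).tsum_eq, ← Real.norm_eq_abs]
  refine tsum_of_norm_bounded (summable_overlapSum hβ hN hp k).hasSum fun n => ?_
  have hpull : ∀ c : ℝ, avgIdx N p k (fun im => c *
      OmegaB β im (n + 1) (fun σs => qOv N (n + 1) σs ^ p)) = c *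
      avgIdx N p k (fun im => OmegaB β im (n + 1) (fun σs => qOv N (n + 1) σs ^ p)) := fun c => by
    rw [avgIdx, avgIdx, ← Finset.mul_sum, mul_left_comm]
  have hθ : 0 < Real.tanh β := tanh_pos_of_pos hβ
  rw [hpull, norm_mul, Real.norm_of_nonneg (avgIdx_OmegaB_nonneg hp k _), norm_neg, norm_div,
    norm_pow, norm_neg, Real.norm_of_nonneg hθ.le,
    Real.norm_of_nonneg (by positivity : (0 : ℝ) ≤ (n : ℝ) + 1)]

lemma exists_abs_meanLogZ_le (hβ : 0 < β) (hN : N ≠ 0) (hp : Even p) :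
    ∃ C, ∀ k, |meanLogZ β N p k| ≤ C * 2 ^ k := by
  set D := |Real.log (Real.cosh β)| + ∑' n : ℕ, Real.tanh β ^ (n + 1) / ((n : ℝ) + 1)
  have hstep (k : ℕ) : |meanLogZ β N p (k + 1)| ≤ |meanLogZ β N p k| + D := by
    have h := (abs_meanLogZ_succ_sub_le hβ hN hp k).trans (overlapSum_le hβ hN hp k)
    have h' : meanLogZ β N p (k + 1) = meanLogZ β N p k + (Real.log (Real.cosh β) +
        (meanLogZ β N p (k + 1) - meanLogZ β N p k - Real.log (Real.cosh β))) := by ring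
    rw [h']
    exact (abs_add_le _ _).trans
      (add_le_add le_rfl ((abs_add_le _ _).trans (add_le_add le_rfl h)))
  have hD : 0 ≤ D := add_nonneg (abs_nonneg _) (tsum_nonneg fun n => tanh_pow_div_nonneg hβ n)
  refine ⟨|meanLogZ β N p 0| + D, fun k => ?_⟩
  induction k with
  | zero => simpa using hD
  | succ k ih =>
    have h0 := abs_nonneg (meanLogZ β N p 0)
    have h2 : (1 : ℝ) ≤ 2 ^ k := one_le_pow₀ (by norm_num)
    have h3 : D ≤ (|meanLogZ β N p 0| + D) * 2 ^ k := by nlinarith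
    rw [pow_succ]
    linarith [hstep k]

end Increment

/-! ### Poisson averages -/

lemma pois_nonneg {r : ℝ} (hr : 0 ≤ r) (k : ℕ) : 0 ≤ pois r k := by
  unfold pois; positivity

lemma hasSum_pois (r : ℝ) : HasSum (pois r) 1 := by
  have h := (NormedSpace.expSeries_div_hasSum_exp r).mul_left (Real.exp (-r))
  rw [← Real.exp_eq_exp_ℝ, ← Real.exp_add, neg_add_cancel, Real.exp_zero] at h
  exact h.congr_fun fun k => mul_div_assoc _ _ _

lemma summable_mul_pow_div_factorial {a : ℕ → ℝ} {C M : ℝ} (ha : ∀ k, |a k| ≤ C * M ^ k) (x : ℝ) :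
    Summable (fun k : ℕ => a k * (x ^ k / k.factorial)) := by
  refine Summable.of_norm_bounded ((Real.summable_pow_div_factorial (M * |x|)).mul_left C)
    fun k => ?_
  rw [norm_mul, norm_div, norm_pow, Real.norm_natCast, Real.norm_eq_abs, Real.norm_eq_abs, mul_pow,
    mul_div_assoc, ← mul_assoc]
  exact mul_le_mul_of_nonneg_right (ha k) (by positivity)

lemma hasDerivAt_tsum_pow_div_factorial {a : ℕ → ℝ} {C M : ℝ} (ha : ∀ k, |a k| ≤ C * M ^ k)
    (x : ℝ) :
    HasDerivAt (fun y => ∑' k : ℕ, a k * (y ^ k / k.factorial))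
      (∑' k : ℕ, a (k + 1) * (x ^ k / k.factorial)) x := by
  set R := |x| + 1
  have hsucc (k : ℕ) (y : ℝ) :
      ((k + 1 : ℕ) : ℝ) * y ^ (k + 1 - 1) / (k + 1).factorial = y ^ k / k.factorial := by
    rw [Nat.factorial_succ, Nat.cast_mul, Nat.add_sub_cancel,
      mul_div_mul_left _ _ (Nat.cast_ne_zero.2 k.succ_ne_zero)]
  have ha' (k : ℕ) : |a (k + 1)| ≤ C * M * M ^ k := by
    rw [mul_assoc, ← pow_succ']; exact ha (k + 1)
  have hu : Summable (fun k : ℕ => |a k| * (k * R ^ (k - 1) / k.factorial)) := by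
    rw [← summable_nat_add_iff 1]
    simp only [hsucc]
    exact summable_mul_pow_div_factorial (a := fun k => |a (k + 1)|)
      (fun k => by simpa using ha' k) R
  have hbound (k : ℕ) (y : ℝ) (hy : y ∈ Metric.ball (0 : ℝ) R) :
      ‖a k * (k * y ^ (k - 1) / k.factorial)‖ ≤ |a k| * (k * R ^ (k - 1) / k.factorial) := by
    have hy' : |y| ≤ R := by simpa using (Metric.mem_ball.1 hy).le
    rw [norm_mul, norm_div, norm_mul, norm_pow, Real.norm_natCast, Real.norm_natCast,
      Real.norm_eq_abs, Real.norm_eq_abs]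
    gcongr
  have hx : x ∈ Metric.ball (0 : ℝ) R := by simp [R]
  have hmain := hasDerivAt_tsum_of_isPreconnected hu Metric.isOpen_ball
    (convex_ball (0 : ℝ) R).isPreconnected
    (g := fun k y => a k * (y ^ k / k.factorial))
    (g' := fun k y => a k * (k * y ^ (k - 1) / k.factorial))
    (fun k y _ => ((hasDerivAt_pow k y).div_const _).const_mul _) hbound hx
    (summable_mul_pow_div_factorial ha x) hx
  have hs : Summable (fun k : ℕ => a k * (k * x ^ (k - 1) / k.factorial)) :=
    Summable.of_norm_bounded hu fun k => hbound k x hx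
  rw [hs.tsum_eq_zero_add] at hmain
  simpa only [hsucc, Nat.cast_zero, zero_mul, zero_div, mul_zero, zero_add] using hmain

lemma summable_pois_mul {a : ℕ → ℝ} {C M : ℝ} (ha : ∀ k, |a k| ≤ C * M ^ k) (x : ℝ) :
    Summable (fun k => pois x k * a k) := by
  refine ((summable_mul_pow_div_factorial ha x).mul_left (Real.exp (-x))).congr fun k => ?_
  rw [pois]; ring

lemma tsum_pois_mul (a : ℕ → ℝ) (x : ℝ) :
    ∑' k, pois x k * a k = Real.exp (-x) * ∑' k : ℕ, a k * (x ^ k / k.factorial) := by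
  rw [← tsum_mul_left]
  refine tsum_congr fun k => ?_
  rw [pois]; ring

lemma hasDerivAt_tsum_pois_mul {a : ℕ → ℝ} {C M : ℝ} (ha : ∀ k, |a k| ≤ C * M ^ k) (x : ℝ) :
    HasDerivAt (fun y => ∑' k, pois y k * a k) (∑' k, pois x k * (a (k + 1) - a k)) x := by
  have ha' (k : ℕ) : |a (k + 1)| ≤ C * M * M ^ k := by
    rw [mul_assoc, ← pow_succ']; exact ha (k + 1)
  simp only [tsum_pois_mul, mul_sub]
  rw [(summable_pois_mul ha' x).tsum_sub (summable_pois_mul ha x), tsum_pois_mul, tsum_pois_mul]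
  refine ((hasDerivAt_neg x).exp.mul (hasDerivAt_tsum_pow_div_factorial ha x)).congr_deriv ?_
  ring

section Pressure

variable {β : ℝ} {N p : ℕ}

lemma hasDerivAt_pressure (hβ : 0 < β) (hN : N ≠ 0) (hp : Even p) (γ : ℝ) :
    HasDerivAt (fun γ => pressure N p γ β)
      (∑' k, pois (γ * N) k * (meanLogZ β N p (k + 1) - meanLogZ β N p k)) γ := by
  obtain ⟨C, hC⟩ := exists_abs_meanLogZ_le hβ hN hp
  have hN' : (N : ℝ) ≠ 0 := Nat.cast_ne_zero.2 hN
  have h := ((hasDerivAt_tsum_pois_mul hC (γ * N)).comp γ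
    ((hasDerivAt_id γ).mul_const (N : ℝ))).const_mul (N : ℝ)⁻¹
  refine h.congr_deriv ?_
  rw [one_mul, mul_comm, mul_inv_cancel_right₀ hN']

lemma pressure_zero (hN : N ≠ 0) : pressure N p 0 β = Real.log 2 := by
  have hN' : (N : ℝ) ≠ 0 := Nat.cast_ne_zero.2 hN
  have h0 : meanLogZ β N p 0 = N * Real.log 2 := by
    simp [meanLogZ, avgIdx, Zpart, intSum]
  have h : ElnZ N p 0 β = N * Real.log 2 := by
    rw [← h0]
    change ∑' k, pois (0 * N) k * meanLogZ β N p k = _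
    rw [tsum_eq_single 0 fun k hk => by simp [pois, hk]]
    simp [pois]
  rw [pressure, h, inv_mul_cancel_left₀ hN']

lemma tsum_pois_mul_overlapSum (hβ : 0 < β) (hN : N ≠ 0) (hp : Even p) {γ : ℝ} (hγ : 0 ≤ γ) :
    ∑' k, pois (γ * N) k * overlapSum β N p k =
      ∑' n : ℕ, Real.tanh β ^ (n + 1) / ((n : ℝ) + 1) * qPowAvg N p γ β (n + 1) p := by
  have hγN : 0 ≤ γ * N := by positivity
  simp only [overlapSum, qPowAvg, Equench, ← tsum_mul_left]
  rw [Summable.tsum_comm]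
  · exact tsum_congr fun n => tsum_congr fun k => mul_left_comm _ _ _
  · refine Summable.of_nonneg_of_le (fun x => ?_) (fun x => ?_)
      ((summable_tanh_pow_div β).mul_of_nonneg (hasSum_pois (γ * N)).summable
        (fun n => tanh_pow_div_nonneg hβ n) (fun k => pois_nonneg hγN k))
    · exact mul_nonneg (pois_nonneg hγN _)
        (mul_nonneg (tanh_pow_div_nonneg hβ _) (avgIdx_OmegaB_nonneg hp _ _))
    · rw [mul_comm (_ / _)]
      exact mul_le_mul_of_nonneg_left (mul_le_of_le_one_right (tanh_pow_div_nonneg hβ _)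
        (avgIdx_OmegaB_le_one hN _ _)) (pois_nonneg hγN _)

lemma summable_pois_mul_overlapSum (hβ : 0 < β) (hN : N ≠ 0) (hp : Even p) (x : ℝ) :
    Summable (fun k => pois x k * overlapSum β N p k) :=
  summable_pois_mul (C := ∑' n : ℕ, Real.tanh β ^ (n + 1) / ((n : ℝ) + 1)) (M := 1)
    (fun k => by
      rw [abs_of_nonneg (overlapSum_nonneg hβ hp k), one_pow, mul_one]
      exact overlapSum_le hβ hN hp k) x

lemma tsum_mul_qPowAvg_le (hβ : 0 < β) (hN : N ≠ 0) (hp : Even p) {γ : ℝ} (hγ : 0 ≤ γ) :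
    ∑' n : ℕ, Real.tanh β ^ (n + 1) / ((n : ℝ) + 1) * qPowAvg N p γ β (n + 1) p ≤
      ∑' n : ℕ, Real.tanh β ^ (n + 1) / ((n : ℝ) + 1) := by
  rw [← tsum_pois_mul_overlapSum hβ hN hp hγ]
  have h := (hasSum_pois (γ * N)).mul_right (∑' n : ℕ, Real.tanh β ^ (n + 1) / ((n : ℝ) + 1))
  rw [one_mul] at h
  rw [← h.tsum_eq]
  exact (summable_pois_mul_overlapSum hβ hN hp _).tsum_le_tsum (fun k => mul_le_mul_of_nonneg_left
    (overlapSum_le hβ hN hp k) (pois_nonneg (by positivity) k)) h.summable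

lemma abs_deriv_pressure_sub_le (hβ : 0 < β) (hN : N ≠ 0) (hp : Even p) {γ : ℝ} (hγ : 0 ≤ γ) :
    |∑' k, pois (γ * N) k * (meanLogZ β N p (k + 1) - meanLogZ β N p k) -
        Real.log (Real.cosh β)| ≤
      ∑' n : ℕ, Real.tanh β ^ (n + 1) / ((n : ℝ) + 1) * qPowAvg N p γ β (n + 1) p := by
  have hγN : 0 ≤ γ * N := by positivity
  have hs := summable_pois_mul_overlapSum hβ hN hp (γ * N)
  have hle (k : ℕ) : ‖pois (γ * N) k * (meanLogZ β N p (k + 1) - meanLogZ β N p k -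
      Real.log (Real.cosh β))‖ ≤ pois (γ * N) k * overlapSum β N p k := by
    rw [norm_mul, Real.norm_of_nonneg (pois_nonneg hγN k)]
    exact mul_le_mul_of_nonneg_left (abs_meanLogZ_succ_sub_le hβ hN hp k) (pois_nonneg hγN k)
  have hL := (hasSum_pois (γ * N)).mul_right (Real.log (Real.cosh β))
  have hsum : HasSum (fun k => pois (γ * N) k * (meanLogZ β N p (k + 1) - meanLogZ β N p k))
      (∑' k, pois (γ * N) k * (meanLogZ β N p (k + 1) - meanLogZ β N p k -
        Real.log (Real.cosh β)) + 1 * Real.log (Real.cosh β)) := by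
    refine ((Summable.of_norm_bounded hs hle).hasSum.add hL).congr_fun fun k => ?_
    ring
  rw [hsum.tsum_eq, one_mul, add_sub_cancel_right, ← tsum_pois_mul_overlapSum hβ hN hp hγ,
    ← Real.norm_eq_abs]
  exact tsum_of_norm_bounded hs.hasSum hle

lemma abs_pressure_sub_le (hβ : 0 < β) (hN : N ≠ 0) (hp : Even p) {α : ℝ} (hα : 0 < α) :
    |pressure N p α β - (Real.log 2 + α * Real.log (Real.cosh β))| ≤
      α * ⨆ a : Set.Ioc (0 : ℝ) α, ∑' n : ℕ,
        Real.tanh β ^ (n + 1) / ((n : ℝ) + 1) * qPowAvg N p (a : ℝ) β (n + 1) p := by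
  obtain ⟨c, hc, hslope⟩ := exists_hasDerivAt_eq_slope (fun γ => pressure N p γ β) _ hα
    (fun γ _ => (hasDerivAt_pressure hβ hN hp γ).continuousAt.continuousWithinAt)
    (fun γ _ => hasDerivAt_pressure hβ hN hp γ)
  have hbdd : BddAbove (Set.range fun a : Set.Ioc (0 : ℝ) α => ∑' n : ℕ,
      Real.tanh β ^ (n + 1) / ((n : ℝ) + 1) * qPowAvg N p (a : ℝ) β (n + 1) p) :=
    ⟨_, Set.forall_mem_range.2 fun a => tsum_mul_qPowAvg_le hβ hN hp a.2.1.le⟩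
  have h := (abs_deriv_pressure_sub_le hβ hN hp hc.1.le).trans
    (le_ciSup hbdd ⟨c, hc.1, hc.2.le⟩)
  rw [hslope, pressure_zero hN, sub_zero] at h
  have heq : pressure N p α β - (Real.log 2 + α * Real.log (Real.cosh β)) =
      α * ((pressure N p α β - Real.log 2) / α - Real.log (Real.cosh β)) := by
    field_simp
    ring
  rw [heq, abs_mul, abs_of_pos hα]
  exact mul_le_mul_of_nonneg_left h hα.le

end Pressure

end

/-- High-temperature solution of the diluted Curie–Weiss model (`p = 2`, `γ = α`): if the
overlaps vanish in the thermodynamic limit uniformly below connectivity `α`, i.e.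
`sup_{α' ∈ (0,α]} ∑_{n≥1} (θ^n/n) ⟨q_{1…n}²⟩_N(α',β) → 0` with `θ = tanh β`, then
`A_N(α,β) → ln 2 + α ln cosh β`. -/
theorem high_temperature_solution (α β : ℝ) (hα : 0 < α) (hβ : 0 < β)
    (hvanish : Tendsto (fun N : ℕ =>
        ⨆ a : Set.Ioc (0 : ℝ) α,
          ∑' n : ℕ, (Real.tanh β ^ (n + 1) / ((n : ℝ) + 1)) *
            qPowAvg N 2 (a : ℝ) β (n + 1) 2)
      atTop (nhds 0)) :
    Tendsto (fun N : ℕ => pressure N 2 α β) atTop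
      (nhds (Real.log 2 + α * Real.log (Real.cosh β))) := by
  rw [tendsto_iff_dist_tendsto_zero]
  have hlim := hvanish.const_mul α
  rw [mul_zero] at hlim
  refine tendsto_of_tendsto_of_tendsto_of_le_of_le' tendsto_const_nhds hlim
    (Eventually.of_forall fun _ => dist_nonneg) ?_
  filter_upwards [eventually_ne_atTop 0] with N hN
  rw [Real.dist_eq]
  exact abs_pressure_sub_le hβ hN even_two hα
end

section
/- Fix α > 0, β > 0, n ∈ ℕ and distinct indices i_1,…,i_n. Then, with α̃_N = Nα/(N+1), the t = 1 perturbed Boltzmann average of σ_{i_1}⋯σ_{i_n} in the N-spin system equals the unperturbed Boltzmann average of σ_{i_1}⋯σ_{i_n}·σ_{N+1}^n in the (N+1)-spin system up to an error vanishing as N → ∞: there is a constant C = C(α,β,n) such that | E[ω̃_{N,t=1}(σ_{i_1}⋯σ_{i_n})] − E[ω_{N+1}(σ_{i_1}⋯σ_{i_n} σ_{N+1}^n)] | ≤ C/N for all N ≥ max(i_1,…,i_n), where ω̃_{N,t=1} is taken at connectivity α̃_N and ω_{N+1} at connectivity α. -/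
open scoped BigOperators

open scoped BoundedContinuousFunction

noncomputable section

/-- Translation by `m`, acting on bounded continuous functions. -/
def translation {M : Type*} [TopologicalSpace M] [AddCommMonoid M] [ContinuousAdd M] (m : M) :
    (M →ᵇ ℝ) →L[ℝ] (M →ᵇ ℝ) :=
  BoundedContinuousFunction.compContinuousCLM ℝ ℝ ⟨fun u => u + m, by fun_prop⟩

section Translation

variable {M : Type*} [TopologicalSpace M] [AddCommMonoid M] [ContinuousAdd M]

@[simp]
lemma translation_apply (m : M) (f : M →ᵇ ℝ) (u : M) : translation m f u = f (u + m) := rfl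

lemma commute_translation (m m' : M) : Commute (translation m) (translation m') := by
  ext f u
  simp [add_right_comm]

lemma sum_translation_pow_apply {X : Type*} [Fintype X] (v : X → M) (k : ℕ) (f : M →ᵇ ℝ) (u : M) :
    ((∑ x, translation (v x)) ^ k) f u = ∑ x : Fin k → X, f (u + ∑ ν, v (x ν)) := by
  induction k generalizing u with
  | zero => simp
  | succ k ih =>
    rw [pow_succ', ← (Fin.consEquiv fun _ : Fin (k + 1) => X).sum_comp, Fintype.sum_prod_type]
    simp only [mul_apply_eq_comp, sum_apply, BoundedContinuousFunction.sum_apply,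
      translation_apply, ih, Fin.sum_univ_succ, Fin.consEquiv, add_assoc]
    simp

end Translation

/-- The exponential of a bounded operator. -/
def expCLM {E : Type*} [NormedAddCommGroup E] [NormedSpace ℝ E] (A : E →L[ℝ] E) : E →L[ℝ] E :=
  NormedSpace.exp A

lemma hasSum_expCLM_apply {E : Type*} [NormedAddCommGroup E] [NormedSpace ℝ E] [CompleteSpace E]
    (A : E →L[ℝ] E) (f : E) :
    HasSum (fun k : ℕ => ((Nat.factorial k : ℝ)⁻¹) • (A ^ k) f) (expCLM A f) :=
  (NormedSpace.exp_series_hasSum_exp' (𝕂 := ℝ) A).mapL (ContinuousLinearMap.apply ℝ E f)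

lemma expCLM_apply_of_apply_eq_smul {E : Type*} [NormedAddCommGroup E] [NormedSpace ℝ E]
    [CompleteSpace E] (A : E →L[ℝ] E) (f : E) (r : ℝ) (h : A f = r • f) :
    expCLM A f = Real.exp r • f := by
  have hpow : ∀ k : ℕ, (A ^ k) f = r ^ k • f := by
    intro k
    induction k with
    | zero => simp
    | succ k ih => rw [pow_succ, mul_apply_eq_comp, h, map_smul, ih, smul_smul, pow_succ']
  have h1 := hasSum_expCLM_apply A f
  have h2 : HasSum (fun k : ℕ => ((Nat.factorial k : ℝ)⁻¹ • r ^ k) • f) (Real.exp r • f) := by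
    rw [Real.exp_eq_exp_ℝ]
    exact (NormedSpace.exp_series_hasSum_exp' (𝕂 := ℝ) r).smul_const f
  refine h1.unique (h2.congr_fun ?_)
  intro k
  rw [hpow, smul_smul, smul_eq_mul]

lemma expCLM_smul_add_apply {E : Type*} [NormedAddCommGroup E] [NormedSpace ℝ E] [CompleteSpace E]
    {A B : E →L[ℝ] E} (h : Commute A B) (r : ℝ) (f : E) :
    expCLM (r • (A + B)) f = expCLM (r • A) (expCLM (r • B) f) := by
  let _ : NormedAlgebra ℚ (E →L[ℝ] E) := NormedAlgebra.restrictScalars ℚ ℝ _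
  rw [expCLM, smul_add, NormedSpace.exp_add_of_commute ((h.smul_left r).smul_right r)]
  rfl

/-- Averaging over a Poisson number of independent uniform edges is the exponential of a sum of
translations. -/
lemma tsum_pois_avgIdx {M : Type*} [TopologicalSpace M] [AddCommMonoid M] [ContinuousAdd M]
    (N p : ℕ) (lam : ℝ) (v : (Fin p → Fin N) → M) (f : M →ᵇ ℝ) (u : M) :
    ∑' k : ℕ, pois lam k * avgIdx N p k (fun im => f (u + ∑ ν, v (fun l => im l ν))) =
      Real.exp (-lam) *
        expCLM ((lam / (N : ℝ) ^ p) • ∑ x, translation (v x)) f u := by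
  have h := (hasSum_expCLM_apply ((lam / (N : ℝ) ^ p) • ∑ x, translation (v x)) f).mapL
    (BoundedContinuousFunction.evalCLM ℝ u)
  rw [← BoundedContinuousFunction.evalCLM_apply ℝ u, ← h.tsum_eq, ← tsum_mul_left]
  refine tsum_congr fun k => ?_
  have hsum : ∑ im : Fin p → Fin k → Fin N, f (u + ∑ ν, v (fun l => im l ν)) =
      ∑ x : Fin k → Fin p → Fin N, f (u + ∑ ν, v (x ν)) :=
    (Equiv.piComm fun (_ : Fin p) (_ : Fin k) => Fin N).sum_comp
      fun x : Fin k → Fin p → Fin N => f (u + ∑ ν, v (x ν))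
  rw [smul_pow, smul_apply, BoundedContinuousFunction.evalCLM_apply,
    BoundedContinuousFunction.smul_apply, BoundedContinuousFunction.smul_apply,
    sum_translation_pow_apply, avgIdx, hsum, pois, div_pow, ← pow_mul, smul_eq_mul, smul_eq_mul]
  ring

/-- The average of `g` for the Gibbs weight `exp (β u)`. -/
def gibbs {S : Type*} [Fintype S] (β : ℝ) (g u : S → ℝ) : ℝ :=
  (∑ σ, g σ * Real.exp (β * u σ)) / ∑ σ, Real.exp (β * u σ)

lemma abs_gibbs_le {S : Type*} [Fintype S] (β : ℝ) (g u : S → ℝ) :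
    |gibbs β g u| ≤ ∑ σ, |g σ| := by
  rw [gibbs, Finset.sum_div]
  refine (Finset.abs_sum_le_sum_abs _ _).trans (Finset.sum_le_sum fun σ _ => ?_)
  have hle : Real.exp (β * u σ) ≤ ∑ σ, Real.exp (β * u σ) :=
    Finset.single_le_sum (f := fun σ => Real.exp (β * u σ))
      (fun _ _ => (Real.exp_pos _).le) (Finset.mem_univ σ)
  have hpos := (Real.exp_pos (β * u σ)).trans_le hle
  rw [abs_div, abs_mul, Real.abs_exp, abs_of_pos hpos, div_le_iff₀ hpos]
  exact mul_le_mul_of_nonneg_left hle (abs_nonneg _)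

lemma continuous_gibbs {S : Type*} [Fintype S] [Nonempty S] (β : ℝ) (g : S → ℝ) :
    Continuous (gibbs β g) := by
  unfold gibbs
  refine Continuous.div (by fun_prop) (by fun_prop) fun u => ?_
  exact (Finset.sum_pos (fun _ _ => Real.exp_pos _) Finset.univ_nonempty).ne'

/-- The Gibbs average, as a bounded continuous function of the exponent. -/
def gibbsBCF {S : Type*} [Fintype S] [Nonempty S] (β : ℝ) (g : S → ℝ) : (S → ℝ) →ᵇ ℝ :=
  BoundedContinuousFunction.ofNormedAddCommGroup (gibbs β g) (continuous_gibbs β g) _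
    (abs_gibbs_le β g)

@[simp]
lemma gibbsBCF_apply {S : Type*} [Fintype S] [Nonempty S] (β : ℝ) (g u : S → ℝ) :
    gibbsBCF β g u = gibbs β g u := rfl

lemma gibbs_add_const {S : Type*} [Fintype S] (β : ℝ) (g u : S → ℝ) (c : ℝ) :
    gibbs β g (u + fun _ => c) = gibbs β g u := by
  simp only [gibbs, Pi.add_apply, mul_add, Real.exp_add, ← mul_assoc, ← Finset.sum_mul]
  exact mul_div_mul_right _ _ (Real.exp_ne_zero _)

lemma sum_eq_two_mul_sum_snoc_true {N : ℕ} (h : (Fin (N + 1) → Bool) → ℝ)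
    (hflip : ∀ τ, h (fun i => !τ i) = h τ) :
    ∑ τ, h τ = 2 * ∑ σ : Fin N → Bool, h (Fin.snoc (α := fun _ => Bool) σ true) := by
  have hfalse : ∑ σ : Fin N → Bool, h (Fin.snoc (α := fun _ => Bool) σ false) =
      ∑ σ : Fin N → Bool, h (Fin.snoc (α := fun _ => Bool) σ true) := by
    rw [← (Equiv.arrowCongr (Equiv.refl (Fin N)) Equiv.boolNot).sum_comp]
    refine Finset.sum_congr rfl fun σ _ => ?_
    rw [← hflip]
    congr 1
    funext i
    refine Fin.lastCases ?_ (fun j => ?_) i <;> simp [Equiv.arrowCongr]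
  rw [← (Fin.snocEquiv fun _ : Fin (N + 1) => Bool).sum_comp, Fintype.sum_prod_type,
    Fintype.sum_bool]
  simp only [Fin.snocEquiv, Equiv.coe_fn_mk]
  rw [hfalse, two_mul]

/-- A Gibbs average invariant under the global flip can be computed by fixing the last spin. -/
lemma gibbs_eq_gibbs_snoc_true {N : ℕ} (β : ℝ) (g u : (Fin (N + 1) → Bool) → ℝ)
    (hg : ∀ τ, g (fun i => !τ i) = g τ) (hu : ∀ τ, u (fun i => !τ i) = u τ) :
    gibbs β g u = gibbs β (fun σ : Fin N → Bool => g (Fin.snoc (α := fun _ => Bool) σ true))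
      (fun σ => u (Fin.snoc (α := fun _ => Bool) σ true)) := by
  rw [gibbs, gibbs,
    sum_eq_two_mul_sum_snoc_true (fun τ => g τ * Real.exp (β * u τ)) (by simp [hg, hu]),
    sum_eq_two_mul_sum_snoc_true (fun τ => Real.exp (β * u τ)) (by simp [hu])]
  exact mul_div_mul_left _ _ two_ne_zero

lemma spin_not (b : Bool) : spin (!b) = -spin b := by
  cases b <;> simp [spin]

lemma sum_fin_one_fun {S : Type*} [Fintype S] (h : (Fin 1 → S) → ℝ) :
    ∑ σs, h σs = ∑ σ, h (fun _ => σ) :=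
  Fintype.sum_equiv (Equiv.funUnique (Fin 1) S) _ _ fun σs =>
    congrArg h (funext fun i => congrArg σs (Subsingleton.elim i _))

lemma OmegaB_one (β : ℝ) {N p k : ℕ} (im : Fin p → Fin k → Fin N)
    (g : (Fin 1 → Fin N → Bool) → ℝ) :
    OmegaB β im 1 g = gibbs β (fun σ => g (fun _ => σ)) (intSum im) := by
  rw [OmegaB, gibbs, Zpart, pow_one, sum_fin_one_fun]
  simp

lemma OmegaPert_one (β : ℝ) {N p k q k' : ℕ} (im : Fin p → Fin k → Fin N)
    (im' : Fin q → Fin k' → Fin N) (g : (Fin 1 → Fin N → Bool) → ℝ) :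
    OmegaPert β im im' 1 g = gibbs β (fun σ => g (fun _ => σ)) (intSum im + cavSum im') := by
  rw [OmegaPert, gibbs, Zpert, pow_one, sum_fin_one_fun]
  simp [wpert]

/-- The product of spins over a family of sites, as a function of the configuration. -/
def edgeSpin {N p : ℕ} (x : Fin p → Fin N) (σ : Fin N → Bool) : ℝ := ∏ l, spin (σ (x l))

lemma intSum_eq {N p k : ℕ} (im : Fin p → Fin k → Fin N) :
    intSum im = ∑ ν, edgeSpin (fun l => im l ν) := by
  ext σ
  simp [intSum, edgeSpin]

lemma cavSum_eq {N q k : ℕ} (im : Fin q → Fin k → Fin N) :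
    cavSum im = ∑ ν, edgeSpin (fun l => im l ν) := intSum_eq im

/-- The product of spins over a family of sites, with the last spin fixed to be `1`. -/
def edgeSpinSnoc {N p : ℕ} (x : Fin p → Fin (N + 1)) (σ : Fin N → Bool) : ℝ :=
  edgeSpin x (Fin.snoc (α := fun _ => Bool) σ true)

lemma sum_translation_edgeSpinSnoc (N : ℕ) :
    ∑ x : Fin 2 → Fin (N + 1), translation (edgeSpinSnoc x) =
      (∑ x : Fin 2 → Fin N, translation (edgeSpin x) +
        (∑ x : Fin 1 → Fin N, translation (edgeSpin x) +
          ∑ x : Fin 1 → Fin N, translation (edgeSpin x))) +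
      translation (fun _ => 1) := by
  rw [← (finTwoArrowEquiv (Fin (N + 1))).symm.sum_comp, ← (finTwoArrowEquiv (Fin N)).symm.sum_comp,
    ← (Equiv.funUnique (Fin 1) (Fin N)).symm.sum_comp]
  simp only [Fintype.sum_prod_type, Fin.sum_univ_castSucc, Finset.sum_add_distrib]
  have h1 : ∀ i j : Fin N, edgeSpinSnoc ![i.castSucc, j.castSucc] = edgeSpin ![i, j] := by
    intro i j; ext σ; simp [edgeSpinSnoc, edgeSpin]
  have h2 : ∀ i : Fin N, edgeSpinSnoc ![i.castSucc, Fin.last N] =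
      edgeSpin ((Equiv.funUnique (Fin 1) (Fin N)).symm i) := by
    intro i; ext σ; simp [edgeSpinSnoc, edgeSpin, spin]
  have h3 : ∀ i : Fin N, edgeSpinSnoc ![Fin.last N, i.castSucc] =
      edgeSpin ((Equiv.funUnique (Fin 1) (Fin N)).symm i) := by
    intro i; ext σ; simp [edgeSpinSnoc, edgeSpin, spin]
  have h4 : edgeSpinSnoc ![Fin.last N, Fin.last N] = fun _ => 1 := by
    ext σ; simp [edgeSpinSnoc, edgeSpin, spin]
  simp only [finTwoArrowEquiv_symm_apply, h1, h2, h3, h4]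
  abel

lemma EquenchCav_gibbs (N : ℕ) (γ t β : ℝ) (g : (Fin N → Bool) → ℝ) :
    EquenchCav N 2 γ t (fun _ im _ im' => gibbs β g (intSum im + cavSum im')) =
      Real.exp (-(γ * N)) * (Real.exp (-(2 * γ * t)) *
        expCLM ((γ * N / (N : ℝ) ^ 2) • ∑ x : Fin 2 → Fin N, translation (edgeSpin x))
          (expCLM ((2 * γ * t / (N : ℝ) ^ 1) •
            ∑ x : Fin 1 → Fin N, translation (edgeSpin x)) (gibbsBCF β g)) 0) := by
  have h := tsum_pois_avgIdx N 2 (γ * N) edgeSpin (Real.exp (-(2 * γ * t)) •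
    expCLM ((2 * γ * t / (N : ℝ) ^ 1) •
      ∑ x : Fin 1 → Fin N, translation (edgeSpin x)) (gibbsBCF β g)) 0
  rw [map_smul, BoundedContinuousFunction.smul_apply, smul_eq_mul] at h
  rw [← h, EquenchCav]
  refine tsum_congr fun k => ?_
  congr 2
  funext im
  rw [BoundedContinuousFunction.smul_apply, smul_eq_mul, ← tsum_pois_avgIdx N 1]
  simp only [intSum_eq, cavSum_eq, zero_add, gibbsBCF_apply]

lemma Equench_gibbs_snoc (N : ℕ) (γ β : ℝ) (g : (Fin N → Bool) → ℝ) :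
    Equench (N + 1) 2 γ (fun _ im =>
        gibbs β g (fun σ => intSum im (Fin.snoc (α := fun _ => Bool) σ true))) =
      Real.exp (-(γ * (N + 1 : ℕ))) *
        expCLM ((γ * (N + 1 : ℕ) / ((N + 1 : ℕ) : ℝ) ^ 2) •
          ∑ x : Fin 2 → Fin (N + 1), translation (edgeSpinSnoc x)) (gibbsBCF β g) 0 := by
  rw [← tsum_pois_avgIdx (N + 1) 2, Equench]
  refine tsum_congr fun k => ?_
  congr 2
  funext im
  rw [gibbsBCF_apply, zero_add]
  congr 1
  ext σ
  simp [edgeSpinSnoc, intSum_eq]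

/-- Adding one spin to the system amounts, after fixing the added spin, to switching on the
cavity field at a reduced connectivity. -/
lemma EquenchCav_gibbs_eq_Equench_gibbs_snoc (N : ℕ) (α β : ℝ) (g : (Fin N → Bool) → ℝ) :
    EquenchCav N 2 ((N : ℝ) * α / ((N : ℝ) + 1)) 1
        (fun _ im _ im' => gibbs β g (intSum im + cavSum im')) =
      Equench (N + 1) 2 α (fun _ im =>
        gibbs β g (fun σ => intSum im (Fin.snoc (α := fun _ => Bool) σ true))) := by
  rw [EquenchCav_gibbs, Equench_gibbs_snoc, sum_translation_edgeSpinSnoc]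
  set B := ∑ x : Fin 2 → Fin N, translation (edgeSpin x) with hB
  set A := ∑ x : Fin 1 → Fin N, translation (edgeSpin x) with hA
  have hN : (N : ℝ) + 1 ≠ 0 := by positivity
  set r : ℝ := α / ((N : ℝ) + 1) with hr
  have hBA : Commute B A := by
    rw [hB, hA]
    exact Commute.sum_left _ _ _ fun _ _ =>
      Commute.sum_right _ _ _ fun _ _ => commute_translation _ _
  have hT : Commute (B + (A + A)) (translation fun _ => 1) := by
    rw [hB, hA]
    have hsum := Commute.sum_left Finset.univ _ _ fun (x : Fin 1 → Fin N) _ =>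
      commute_translation (edgeSpin x) fun _ => 1
    exact (Commute.sum_left _ _ _ fun _ _ => commute_translation _ _).add_left (hsum.add_left hsum)
  have hrate : α * (N + 1 : ℕ) / ((N + 1 : ℕ) : ℝ) ^ 2 = r := by
    rw [hr]; push_cast; field_simp
  have hrateB : ((N : ℝ) * α / ((N : ℝ) + 1) * N / (N : ℝ) ^ 2) • B = r • B := by
    rcases Nat.eq_zero_or_pos N with rfl | hpos
    · simp [hB]
    · congr 1
      rw [hr]
      field_simp
  have hrateA : (2 * ((N : ℝ) * α / ((N : ℝ) + 1)) * 1 / (N : ℝ) ^ 1) • A = r • (A + A) := by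
    rcases Nat.eq_zero_or_pos N with rfl | hpos
    · simp [hA]
    · rw [← two_smul ℝ A, smul_smul]
      congr 1
      rw [hr]
      field_simp
  have hconst : (r • translation (fun _ => 1)) (gibbsBCF β g) = r • gibbsBCF β g := by
    ext u
    simp [gibbs_add_const]
  rw [hrate, hrateB, hrateA, expCLM_smul_add_apply hT, expCLM_apply_of_apply_eq_smul _ _ r hconst,
    map_smul, expCLM_smul_add_apply (hBA.add_right hBA),
    BoundedContinuousFunction.smul_apply, smul_eq_mul, ← mul_assoc, ← mul_assoc, ← Real.exp_add,
    ← Real.exp_add]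
  congr 2
  rw [hr]
  push_cast
  field_simp
  ring

end

/-- Cavity identity for fillable monomials (diluted Curie–Weiss model, `p = 2`, `γ = α`):
for distinct spin indices `i_1, …, i_n`, the `t = 1` perturbed Boltzmann average of
`σ_{i_1}⋯σ_{i_n}` in the `N`-spin system at connectivity `α̃_N = Nα/(N+1)` equals the
unperturbed Boltzmann average of `σ_{i_1}⋯σ_{i_n} σ_{N+1}^n` in the `(N+1)`-spin system at
connectivity `α`, up to an error bounded by `C/N`. -/
theorem cavity_spin_identity (α β : ℝ) (hα : 0 < α) (hβ : 0 < β) (n : ℕ)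
    (idx : Fin n → ℕ) (hinj : Function.Injective idx) :
    ∃ C : ℝ, ∀ N : ℕ, ∀ hlt : ∀ m : Fin n, idx m < N,
      |EquenchCav N 2 ((N : ℝ) * α / ((N : ℝ) + 1)) 1 (fun _ im _ im' =>
          OmegaPert β im im' 1 (fun σs => ∏ m : Fin n, spin (σs 0 ⟨idx m, hlt m⟩)))
        - Equench (N + 1) 2 α (fun _ im =>
          OmegaB β im 1 (fun σs =>
            (∏ m : Fin n, spin (σs 0 ⟨idx m, Nat.lt_succ_of_lt (hlt m)⟩)) *
              spin (σs 0 (Fin.last N)) ^ n))| ≤ C / N := by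
  refine ⟨0, fun N hlt => ?_⟩
  rw [zero_div, abs_nonpos_iff, sub_eq_zero]
  simp only [OmegaPert_one, OmegaB_one]
  rw [EquenchCav_gibbs_eq_Equench_gibbs_snoc]
  congr 1
  funext k im
  rw [gibbs_eq_gibbs_snoc_true]
  · congr 1
    funext σ
    have hm : ∀ m, (⟨idx m, Nat.lt_succ_of_lt (hlt m)⟩ : Fin (N + 1)) =
        Fin.castSucc ⟨idx m, hlt m⟩ := fun m => rfl
    simp only [hm, Fin.snoc_castSucc, Fin.snoc_last]
    simp [spin]
  · intro τ
    simp only [spin_not, Finset.prod_neg, Finset.card_univ, Fintype.card_fin]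
    rw [neg_pow (spin (τ (Fin.last N)))]
    linear_combination (∏ m, spin (τ ⟨idx m, Nat.lt_succ_of_lt (hlt m)⟩)) *
      spin (τ (Fin.last N)) ^ n * ((even_two_mul n).neg_one_pow : (-1 : ℝ) ^ (2 * n) = 1)
  · intro τ
    simp [intSum, Fin.prod_univ_two, spin_not]
end
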